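/- Let σ1 > 0, α > 0, λ > 0, μ1 ≥ 0, K > 0, and let 0 < u1 < u2 < K. Then there is no function V : [u1, u2] → ℝ which is continuously differentiable on [u1, u2] (with one-sided derivatives at the endpoints), twice continuously differentiable on (u1, u2), and satisfies all of the following: V(s) ≥ K − s for all s ∈ [u1, u2]; μ1 s V'(s) + (1/2)σ1² s² V''(s) + λ(K − s) − (α + λ)V(s) = 0 for all s ∈ (u1, u2); V(u1) = K − u1; V'(u1) = −1; V(u2) = K − u2; and V'(u2) = −1. -/

import Mathlib

open Real Set

open Filter Topology in
/-- The necessary second-order condition at a local maximum. -/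
theorem IsLocalMax.deriv_deriv_nonpos {f : ℝ → ℝ} {a : ℝ} (h : IsLocalMax f a)
    (hf : ContinuousAt f a) : deriv (deriv f) a ≤ 0 := by
  by_contra! hpos
  have hmin : IsLocalMin f a := isLocalMin_of_deriv_deriv_pos hpos h.deriv_eq_zero hf
  have hconst : f =ᶠ[𝓝 a] fun _ => f a := by
    filter_upwards [h, hmin] with x hx hx' using le_antisymm hx hx'
  have hzero := hconst.deriv.deriv_eq
  simp only [deriv_const'] at hzero
  exact hpos.ne' (by simpa using hzero)

/-- A continuous function on `[a, b]` which is bounded below by its common value at the two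
endpoints attains its maximum over `[a, b]` in the open interval. -/
theorem exists_isMaxOn_Ioo_of_endpoints_le {f : ℝ → ℝ} {a b : ℝ} (hab : a < b)
    (hf : ContinuousOn f (Icc a b)) (hfab : f a = f b) (hle : ∀ s ∈ Icc a b, f a ≤ f s) :
    ∃ m ∈ Ioo a b, IsMaxOn f (Icc a b) m := by
  obtain ⟨m, hm, hmax⟩ := isCompact_Icc.exists_isMaxOn (nonempty_Icc.2 hab.le) hf
  by_cases hmI : m ∈ Ioo a b
  · exact ⟨m, hmI, hmax⟩
  have hma : f m = f a := by
    rcases hm.1.eq_or_lt with h | h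
    · rw [← h]
    · rcases hm.2.eq_or_lt with h' | h'
      · rw [h', hfab]
      · exact absurd ⟨h, h'⟩ hmI
  obtain ⟨c, hc⟩ := nonempty_Ioo.2 hab
  exact ⟨c, hc, fun s hs => ((hmax hs).trans_eq hma).trans (hle c (Ioo_subset_Icc_self hc))⟩

/-- Analytic core of Lemma A.2 (case μ1 ≥ 0): no bounded component (u1, u2) of the
continuation region strictly inside (0, K) can touch the gain function K − s smoothly
at both endpoints. -/
theorem stmt_18 (σ1 α lam μ1 K u1 u2 : ℝ)
    (hσ1 : 0 < σ1) (hα : 0 < α) (hlam : 0 < lam) (hμ1 : 0 ≤ μ1) (hK : 0 < K)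
    (hu1 : 0 < u1) (hu12 : u1 < u2) (hu2 : u2 < K) :
    ¬ ∃ V V' V'' : ℝ → ℝ,
      (∀ s ∈ Icc u1 u2, HasDerivWithinAt V (V' s) (Icc u1 u2) s) ∧
      ContinuousOn V' (Icc u1 u2) ∧
      (∀ s ∈ Ioo u1 u2, HasDerivAt V' (V'' s) s) ∧
      ContinuousOn V'' (Ioo u1 u2) ∧
      (∀ s ∈ Icc u1 u2, K - s ≤ V s) ∧
      (∀ s ∈ Ioo u1 u2,
        μ1 * s * V' s + (1/2) * σ1^2 * s^2 * V'' s + lam * (K - s) - (α + lam) * V s = 0) ∧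
      V u1 = K - u1 ∧ V' u1 = -1 ∧ V u2 = K - u2 ∧ V' u2 = -1 := by
  rintro ⟨V, V', V'', hV, -, hV', -, hge, hode, hV1, -, hV2, -⟩
  set W : ℝ → ℝ := fun s => V s - (K - s) with hW
  have hWcont : ContinuousOn W (Icc u1 u2) :=
    ContinuousOn.sub (fun s hs => (hV s hs).continuousWithinAt) (by fun_prop)
  have hW1 : W u1 = 0 := by simp [hW, hV1]
  have hW2 : W u2 = 0 := by simp [hW, hV2]
  obtain ⟨m, hm, hmax⟩ := exists_isMaxOn_Ioo_of_endpoints_le hu12 hWcont (hW1.trans hW2.symm)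
    fun s hs => hW1.trans_le (sub_nonneg.2 (hge s hs))
  have hWderiv : ∀ s ∈ Ioo u1 u2, HasDerivAt W (V' s + 1) s := fun s hs => by
    have h := ((hV s (Ioo_subset_Icc_self hs)).hasDerivAt (Icc_mem_nhds hs.1 hs.2)).sub
      ((hasDerivAt_id s).const_sub K)
    exact h.congr_deriv (by ring)
  have hloc : IsLocalMax W m := hmax.isLocalMax (Icc_mem_nhds hm.1 hm.2)
  have hV'm : V' m + 1 = 0 := hloc.hasDerivAt_eq_zero (hWderiv m hm)
  have hV''m : deriv (deriv W) m = V'' m := by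
    have heq : deriv W =ᶠ[nhds m] fun s => V' s + 1 := by
      filter_upwards [Ioo_mem_nhds hm.1 hm.2] with s hs using (hWderiv s hs).deriv
    rw [heq.deriv_eq, ((hV' m hm).add_const 1).deriv]
  have hnonpos : V'' m ≤ 0 :=
    hV''m ▸ hloc.deriv_deriv_nonpos (hWderiv m hm).continuousAt
  have hmpos : 0 < m := hu1.trans hm.1
  have hVm : V' m = -1 := by linarith
  have hodem := hode m hm
  rw [hVm] at hodem
  have hdiff : (1/2) * σ1^2 * m^2 * V'' m ≤ 0 :=
    mul_nonpos_of_nonneg_of_nonpos (by positivity) hnonpos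
  have hdrift : 0 ≤ μ1 * m := by positivity
  have hgain : 0 < α * (K - m) := mul_pos hα (by linarith [hm.2])
  have hval : 0 ≤ (α + lam) * (V m - (K - m)) :=
    mul_nonneg (by positivity) (sub_nonneg.2 (hge m (Ioo_subset_Icc_self hm)))
  linarith
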